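/- For every D ≥ 0 and P ≥ 0 there exists a probability mass function p on {0,1} × {1,…,6} × {0,1} for a triple (X, U, X̂) such that: (i) the marginal of X is uniform on {0,1}; (ii) the Markov chain condition holds: p(x,u,x̂)·p_U(u) = p_{XU}(x,u)·p_{UX̂}(u,x̂) for all (x,u,x̂); (iii) ∑_{x,u,x̂ : x ≠ x̂} p(x,u,x̂) ≤ D; (iv) ∑_{u : p_U(u)>0} p_U(u)·|p_{X|U}(1|u) − p_{X̂|U}(1|u)| ≤ P; and (v) ∑_{u : p_U(u)>0} p_U(u)·H_b(p_{X|U}(1|u)) = ħ̄(D,P), so that the mutual information satisfies I(X;U) = log 2 − ħ̄(D,P). -/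

import Mathlib

/-- The binary entropy function (natural logarithm, `Real.log 0 = 0`). -/
noncomputable def Hb (a : ℝ) : ℝ :=
  -(a * Real.log a) - (1 - a) * Real.log (1 - a)

/-- The function `ħ(D,P)` from the paper. -/
noncomputable def hbar (D P : ℝ) : ℝ :=
  if D < 1 / 2 then
    Hb ((1 + min D P - Real.sqrt (1 + (min D P) ^ 2 - 2 * D)) / 2)
  else Real.log 2

open Finset

/-- The upper concave envelope of `ħ` over `[0,∞)²`. -/
noncomputable def hbarEnv (D P : ℝ) : ℝ :=
  sSup { v | ∃ (k : ℕ) (α : Fin k → ℝ) (DP : Fin k → ℝ × ℝ),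
    (∀ i, 0 ≤ α i) ∧ (∑ i, α i) = 1 ∧
    (∀ i, 0 ≤ (DP i).1 ∧ 0 ≤ (DP i).2) ∧
    (∑ i, α i • DP i) = (D, P) ∧
    v = ∑ i, α i * hbar (DP i).1 (DP i).2 }

/-- `p` is a probability mass function on the finite type `α`. -/
def IsPMF {α : Type*} [Fintype α] (p : α → ℝ) : Prop :=
  (∀ a, 0 ≤ p a) ∧ ∑ a, p a = 1

/-- The `U`-marginal of a pmf on `{0,1} × U × {0,1}`. -/
noncomputable def margU {U : Type*} [Fintype U] (p : Bool × U × Bool → ℝ) (u : U) : ℝ :=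
  ∑ x, ∑ y, p (x, u, y)

/-- The `(X,U)`-marginal of a pmf on `{0,1} × U × {0,1}`. -/
noncomputable def margXU {U : Type*} [Fintype U] (p : Bool × U × Bool → ℝ)
    (x : Bool) (u : U) : ℝ :=
  ∑ y, p (x, u, y)

/-- The `(U,X̂)`-marginal of a pmf on `{0,1} × U × {0,1}`. -/
noncomputable def margUXhat {U : Type*} [Fintype U] (p : Bool × U × Bool → ℝ)
    (u : U) (y : Bool) : ℝ :=
  ∑ x, p (x, u, y)

/-- A convex combination over more than `finrank ℝ E + 1` points can be supported on one point
fewer, without changing its barycenter and without decreasing the average of `h`. -/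
theorem exists_weights_vanishing {ι E : Type*} [Fintype ι] [AddCommGroup E] [Module ℝ E]
    [FiniteDimensional ℝ E] (hι : Module.finrank ℝ E + 1 < Fintype.card ι)
    (α : ι → ℝ) (p : ι → E) (h : ι → ℝ) (hα : ∀ i, 0 ≤ α i) :
    ∃ (j : ι) (β : ι → ℝ), (∀ i, 0 ≤ β i) ∧ β j = 0 ∧ ∑ i, β i = ∑ i, α i ∧
      ∑ i, β i • p i = ∑ i, α i • p i ∧ ∑ i, α i * h i ≤ ∑ i, β i * h i := by
  obtain ⟨w, hw1, hwp, hwh, i₀, hi₀⟩ : ∃ w : ι → ℝ, ∑ i, w i = 0 ∧ ∑ i, w i • p i = 0 ∧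
      0 ≤ ∑ i, w i * h i ∧ ∃ i, w i ≠ 0 := by
    have hdep : ¬ LinearIndependent ℝ (fun i => ((1 : ℝ), p i)) := fun hli => by
      have := hli.fintype_card_le_finrank
      rw [Module.finrank_prod, Module.finrank_self] at this
      omega
    obtain ⟨w, hw, hne⟩ := Fintype.not_linearIndependent_iff.mp hdep
    have h1 : ∑ i, w i = 0 := by simpa [Prod.fst_sum] using congrArg Prod.fst hw
    have h2 : ∑ i, w i • p i = 0 := by simpa [Prod.snd_sum] using congrArg Prod.snd hw
    rcases le_total 0 (∑ i, w i * h i) with h0 | h0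
    · exact ⟨w, h1, h2, h0, hne⟩
    · refine ⟨fun i => -w i, by simp [h1], by simp [h2], by simpa using h0, ?_⟩
      simpa using hne
  have hneg : (univ.filter fun i => w i < 0).Nonempty := by
    by_contra hcon
    have hnn : ∀ i, 0 ≤ w i := fun i => by
      by_contra hi
      exact hcon ⟨i, by simpa using hi⟩
    exact hi₀ ((Finset.sum_eq_zero_iff_of_nonneg fun i _ => hnn i).mp hw1 i₀ (mem_univ _))
  obtain ⟨j, hj, hmin⟩ := Finset.exists_min_image _ (fun i => α i / (-w i)) hneg
  have hjneg : w j < 0 := by simpa using hj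
  set t := α j / (-w j) with ht
  have ht0 : 0 ≤ t := div_nonneg (hα j) (by linarith)
  refine ⟨j, fun i => α i + t * w i, fun i => ?_, ?_, ?_, ?_, ?_⟩
  · rcases lt_or_ge (w i) 0 with hi | hi
    · have := hmin i (by simpa using hi)
      rw [le_div_iff₀ (by linarith)] at this
      linarith
    · have := hα i
      positivity
  · have : w j ≠ 0 := hjneg.ne
    simp only [ht]
    field_simp
    ring
  · simp [sum_add_distrib, ← mul_sum, hw1]
  · simp [add_smul, sum_add_distrib, mul_smul, ← smul_sum, hwp]
  · simp only [add_mul, sum_add_distrib, mul_assoc, ← mul_sum]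
    nlinarith [mul_nonneg ht0 hwh]

/-- Carathéodory reduction of a convex combination in the plane to three of its points, keeping
the barycenter and not decreasing the average of `f`. -/
theorem exists_three_point_combination (f : ℝ × ℝ → ℝ) (K : Set (ℝ × ℝ)) (n : ℕ)
    (α : Fin (n + 3) → ℝ) (p : Fin (n + 3) → ℝ × ℝ) (hα : ∀ i, 0 ≤ α i) (hp : ∀ i, p i ∈ K) :
    ∃ (β : Fin 3 → ℝ) (q : Fin 3 → ℝ × ℝ), (∀ i, 0 ≤ β i) ∧ (∀ i, q i ∈ K) ∧
      ∑ i, β i = ∑ i, α i ∧ ∑ i, β i • q i = ∑ i, α i • p i ∧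
      ∑ i, α i * f (p i) ≤ ∑ i, β i * f (q i) := by
  induction n with
  | zero =>
    exact ⟨α, p, hα, hp, rfl, rfl, le_rfl⟩
  | succ n ih =>
    obtain ⟨j, β, hβ, hj, h1, h2, h3⟩ := exists_weights_vanishing (by simp) α p
      (fun i => f (p i)) hα
    obtain ⟨γ, q, hγ, hq, g1, g2, g3⟩ := ih (fun i => β ((j : Fin (n + 3 + 1)).succAbove i))
      (fun i => p ((j : Fin (n + 3 + 1)).succAbove i)) (fun i => hβ _) (fun i => hp _)
    have e1 := Fin.sum_univ_succAbove β (j : Fin (n + 3 + 1))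
    have e2 := Fin.sum_univ_succAbove (fun i => β i • p i) (j : Fin (n + 3 + 1))
    have e3 := Fin.sum_univ_succAbove (fun i => β i * f (p i)) (j : Fin (n + 3 + 1))
    simp only [hj, zero_smul, zero_mul, zero_add] at e1 e2 e3
    exact ⟨γ, q, hγ, hq, g1.trans (e1.symm.trans h1), g2.trans (e2.symm.trans h2),
      h3.trans (e3.le.trans g3)⟩

theorem Hb_eq_binEntropy (a : ℝ) : Hb a = Real.binEntropy a := by
  simp only [Hb, Real.binEntropy, Real.log_inv]
  ring

/-- The parameter at which `hbar` evaluates the binary entropy, as a function of the distortion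
and the effective perception level. -/
noncomputable def crossover (q : ℝ × ℝ) : ℝ :=
  (1 + q.2 - Real.sqrt (1 + q.2 ^ 2 - 2 * q.1)) / 2

/-- Distortion and perception pairs with no slack. -/
def tightPairs : Set (ℝ × ℝ) := {q | 0 ≤ q.2 ∧ q.2 ≤ q.1 ∧ q.1 ≤ 1 / 2}

theorem isCompact_tightPairs : IsCompact tightPairs := by
  refine (isCompact_Icc (a := ((0 : ℝ), (0 : ℝ))) (b := (1 / 2, 1 / 2))).of_isClosed_subset ?_ ?_
  · exact (isClosed_le continuous_const continuous_snd).inter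
      ((isClosed_le continuous_snd continuous_fst).inter
        (isClosed_le continuous_fst continuous_const))
  · rintro ⟨d, m⟩ ⟨h1, h2, h3⟩
    simp only at h1 h2 h3
    exact ⟨⟨by simp; linarith, by simp; linarith⟩, ⟨by simp; linarith, by simp; linarith⟩⟩

theorem continuous_binEntropy_crossover :
    Continuous fun q => Real.binEntropy (crossover q) := by
  unfold crossover
  exact Real.binEntropy_continuous.comp (by fun_prop)

theorem le_crossover {q : ℝ × ℝ} (hq : q ∈ tightPairs) : q.2 ≤ crossover q := by
  obtain ⟨h1, h2, h3⟩ := hq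
  have : Real.sqrt (1 + q.2 ^ 2 - 2 * q.1) ≤ 1 - q.2 := by
    apply Real.sqrt_le_iff.mpr
    constructor <;> nlinarith
  unfold crossover
  linarith

theorem crossover_le_half {q : ℝ × ℝ} (hq : q.1 ≤ 1 / 2) : crossover q ≤ 1 / 2 := by
  have : q.2 ≤ Real.sqrt (1 + q.2 ^ 2 - 2 * q.1) := Real.le_sqrt_of_sq_le (by linarith)
  unfold crossover
  linarith

theorem crossover_distortion {q : ℝ × ℝ} (hq : q.1 ≤ 1 / 2) :
    crossover q * (1 - (crossover q - q.2)) + (1 - crossover q) * (crossover q - q.2) = q.1 := by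
  have := Real.sq_sqrt (show 0 ≤ 1 + q.2 ^ 2 - 2 * q.1 by nlinarith [sq_nonneg q.2])
  unfold crossover
  linear_combination (-1 / 2) * this

theorem crossover_mono {q r : ℝ × ℝ} (h1 : q.1 ≤ r.1) (h2 : q.2 ≤ r.2) (hr : r.1 ≤ 1 / 2) :
    crossover q ≤ crossover r := by
  have hs : q.2 ≤ Real.sqrt (1 + q.2 ^ 2 - 2 * q.1) := Real.le_sqrt_of_sq_le (by linarith)
  have hsq := Real.sq_sqrt (show 0 ≤ 1 + q.2 ^ 2 - 2 * q.1 by nlinarith [sq_nonneg q.2])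
  have : Real.sqrt (1 + r.2 ^ 2 - 2 * r.1) ≤
      Real.sqrt (1 + q.2 ^ 2 - 2 * q.1) + (r.2 - q.2) := by
    apply Real.sqrt_le_iff.mpr
    constructor
    · linarith [Real.sqrt_nonneg (1 + q.2 ^ 2 - 2 * q.1)]
    · nlinarith [mul_nonneg (sub_nonneg.mpr hs) (sub_nonneg.mpr h2)]
  unfold crossover
  linarith

theorem binEntropy_crossover_le_hbar {q r : ℝ × ℝ} (hq : q ∈ tightPairs) (h1 : q.1 ≤ r.1)
    (h2 : q.2 ≤ r.2) : Real.binEntropy (crossover q) ≤ hbar r.1 r.2 := by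
  unfold hbar
  split_ifs with hr
  · have hmin : q.2 ≤ min r.1 r.2 := le_min (hq.2.1.trans h1) h2
    have hle : crossover q ≤ crossover (r.1, min r.1 r.2) := crossover_mono h1 hmin hr.le
    have h0 : 0 ≤ crossover q := hq.1.trans (le_crossover hq)
    have hh : crossover (r.1, min r.1 r.2) ≤ 1 / 2 := crossover_le_half hr.le
    rw [Hb_eq_binEntropy]
    refine Real.binEntropy_strictMonoOn.monotoneOn ⟨h0, ?_⟩ ⟨h0.trans hle, ?_⟩ hle
    · linarith
    · exact hh.trans (by norm_num)
  · exact Real.binEntropy_le_log_two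

/-- Removing the slack of a distortion and perception pair does not change `hbar`. -/
theorem exists_tightPair_hbar_eq {r : ℝ × ℝ} (h1 : 0 ≤ r.1) (h2 : 0 ≤ r.2) :
    ∃ q ∈ tightPairs, q ≤ r ∧ hbar r.1 r.2 = Real.binEntropy (crossover q) := by
  by_cases hr : r.1 < 1 / 2
  · refine ⟨(r.1, min r.1 r.2), ⟨le_min h1 h2, min_le_left _ _, hr.le⟩,
      ⟨le_rfl, min_le_right _ _⟩, ?_⟩
    simp only [hbar, hr, if_true, Hb_eq_binEntropy, crossover]
  · refine ⟨(1 / 2, 0), ⟨le_rfl, by norm_num, le_rfl⟩, ⟨not_lt.mp hr, h2⟩, ?_⟩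
    have : crossover (1 / 2, 0) = 2⁻¹ := by norm_num [crossover]
    simp only [hbar, hr, if_false, this, Real.binEntropy_two_inv]

/-- The concave envelope of `hbar` is attained by three tight pairs. -/
theorem exists_hbarEnv_eq (D P : ℝ) (hD : 0 ≤ D) (hP : 0 ≤ P) :
    ∃ (α : Fin 3 → ℝ) (q : Fin 3 → ℝ × ℝ), (∀ i, 0 ≤ α i) ∧ ∑ i, α i = 1 ∧
      (∀ i, q i ∈ tightPairs) ∧ ∑ i, α i • q i ≤ (D, P) ∧
      hbarEnv D P = ∑ i, α i * Real.binEntropy (crossover (q i)) := by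
  let V := {v | ∃ (k : ℕ) (α : Fin k → ℝ) (DP : Fin k → ℝ × ℝ),
    (∀ i, 0 ≤ α i) ∧ (∑ i, α i) = 1 ∧ (∀ i, 0 ≤ (DP i).1 ∧ 0 ≤ (DP i).2) ∧
    (∑ i, α i • DP i) = (D, P) ∧ v = ∑ i, α i * hbar (DP i).1 (DP i).2}
  let S : Set ((Fin 3 → ℝ) × (Fin 3 → ℝ × ℝ)) :=
    (stdSimplex ℝ (Fin 3) ×ˢ Set.univ.pi fun _ => tightPairs) ∩ {z | ∑ i, z.1 i • z.2 i ≤ (D, P)}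
  have hzero : (0 : ℝ × ℝ) ∈ tightPairs := ⟨le_rfl, le_rfl, by norm_num⟩
  have hS : IsCompact S :=
    ((isCompact_stdSimplex ℝ (Fin 3)).prod (isCompact_univ_pi fun _ =>
      isCompact_tightPairs)).inter_right (isClosed_le (by fun_prop) continuous_const)
  have hne : S.Nonempty := by
    refine ⟨(Pi.single 0 1, 0), ⟨single_mem_stdSimplex ℝ 0, fun i _ => hzero⟩, ?_⟩
    exact ⟨by simpa using hD, by simpa using hP⟩
  have hcont : Continuous fun z : (Fin 3 → ℝ) × (Fin 3 → ℝ × ℝ) =>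
      ∑ i, z.1 i * Real.binEntropy (crossover (z.2 i)) := by
    refine continuous_finsetSum _ fun i _ => Continuous.mul (by fun_prop) ?_
    exact continuous_binEntropy_crossover.comp (by fun_prop)
  obtain ⟨⟨α, q⟩, ⟨⟨⟨hα0, hα1⟩, hq⟩, hle⟩, hmax⟩ := hS.exists_isMaxOn hne hcont.continuousOn
  have hle' : ∑ i, α i • q i ≤ (D, P) := hle
  have hqK : ∀ i, q i ∈ tightPairs := fun i => hq i (Set.mem_univ i)
  refine ⟨α, q, hα0, hα1, hqK, hle', ?_⟩
  have hupper : ∀ v ∈ V, v ≤ ∑ i, α i * Real.binEntropy (crossover (q i)) := by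
    rintro v ⟨k, β, r, hβ0, hβ1, hr, hsum, rfl⟩
    choose t htK htr ht using fun i => exists_tightPair_hbar_eq (hr i).1 (hr i).2
    obtain ⟨γ, s, hγ0, hsK, h1, h2, h3⟩ := exists_three_point_combination
      (fun x => Real.binEntropy (crossover x)) tightPairs k
      (Fin.append β 0) (Fin.append t 0)
      (fun i => by refine Fin.addCases (fun i => ?_) (fun i => ?_) i <;> simp [hβ0])
      (fun i => by refine Fin.addCases (fun i => ?_) (fun i => ?_) i <;> simp [htK, hzero])
    simp only [Fin.sum_univ_add, Fin.append_left, Fin.append_right, Pi.zero_apply, zero_mul,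
      zero_smul, sum_const_zero, add_zero] at h1 h2 h3
    have hmem : (γ, s) ∈ S := by
      refine ⟨⟨⟨hγ0, h1.trans hβ1⟩, fun i _ => hsK i⟩, ?_⟩
      change ∑ i, γ i • s i ≤ (D, P)
      rw [h2, ← hsum]
      exact sum_le_sum fun i _ => smul_le_smul_of_nonneg_left (htr i) (hβ0 i)
    calc _ = ∑ i, β i * Real.binEntropy (crossover (t i)) := by simp only [ht]
      _ ≤ ∑ i, γ i * Real.binEntropy (crossover (s i)) := h3
      _ ≤ _ := hmax hmem
  let δ : ℝ × ℝ := (D, P) - ∑ i, α i • q i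
  have hδ : 0 ≤ δ := sub_nonneg.mpr hle'
  have hmem : ∑ i, α i * hbar (q i + δ).1 (q i + δ).2 ∈ V := by
    refine ⟨3, α, fun i => q i + δ, hα0, hα1, fun i => ⟨?_, ?_⟩, ?_, rfl⟩
    · exact add_nonneg ((hqK i).1.trans (hqK i).2.1) hδ.1
    · exact add_nonneg (hqK i).1 hδ.2
    · simp only [smul_add, sum_add_distrib, ← sum_smul, hα1, one_smul]
      exact add_sub_cancel _ _
  refine le_antisymm (csSup_le ⟨_, hmem⟩ hupper) ?_
  refine le_trans (sum_le_sum fun i _ => mul_le_mul_of_nonneg_left ?_ (hα0 i))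
    (le_csSup ⟨_, hupper⟩ hmem)
  exact binEntropy_crossover_le_hbar (hqK i) (le_add_of_nonneg_right hδ.1)
    (le_add_of_nonneg_right hδ.2)

/-- The probability of `x` under a Bernoulli distribution with parameter `a`. -/
def bernoulliMass (a : ℝ) (x : Bool) : ℝ := if x then a else 1 - a

/-- Mixtures of pairs of independent Bernoulli variables, with weights `w` and
parameters `a`, `b`. -/
def bernoulliMixture {U : Type*} (w a b : U → ℝ) (z : Bool × U × Bool) : ℝ :=
  w z.2.1 * (bernoulliMass (a z.2.1) z.1 * bernoulliMass (b z.2.1) z.2.2)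

section bernoulliMixture

variable {U : Type*} [Fintype U] (w a b : U → ℝ)

theorem margU_bernoulliMixture (u : U) : margU (bernoulliMixture w a b) u = w u := by
  simp [margU, bernoulliMixture, bernoulliMass]
  ring

theorem margXU_bernoulliMixture (x : Bool) (u : U) :
    margXU (bernoulliMixture w a b) x u = w u * bernoulliMass (a u) x := by
  cases x <;> simp [margXU, bernoulliMixture, bernoulliMass] <;> ring

theorem margUXhat_bernoulliMixture (u : U) (y : Bool) :
    margUXhat (bernoulliMixture w a b) u y = w u * bernoulliMass (b u) y := by
  cases y <;> simp [margUXhat, bernoulliMixture, bernoulliMass] <;> ring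

theorem bernoulliMixture_markov (x : Bool) (u : U) (y : Bool) :
    bernoulliMixture w a b (x, u, y) * margU (bernoulliMixture w a b) u =
      margXU (bernoulliMixture w a b) x u * margUXhat (bernoulliMixture w a b) u y := by
  rw [margU_bernoulliMixture, margXU_bernoulliMixture, margUXhat_bernoulliMixture,
    bernoulliMixture]
  ring

theorem sum_bernoulliMixture_fst (x : Bool) :
    ∑ u, ∑ y, bernoulliMixture w a b (x, u, y) = ∑ u, w u * bernoulliMass (a u) x :=
  sum_congr rfl fun u _ => margXU_bernoulliMixture w a b x u

variable {w a b}

theorem isPMF_bernoulliMixture (hw : ∀ u, 0 ≤ w u) (hw1 : ∑ u, w u = 1)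
    (ha : ∀ u, a u ∈ Set.Icc 0 1) (hb : ∀ u, b u ∈ Set.Icc 0 1) :
    IsPMF (bernoulliMixture w a b) := by
  have hmass : ∀ c ∈ Set.Icc (0 : ℝ) 1, ∀ x, 0 ≤ bernoulliMass c x := by
    rintro c ⟨h0, h1⟩ (_ | _) <;> simp [bernoulliMass, h0, h1]
  refine ⟨fun z => mul_nonneg (hw _) (mul_nonneg (hmass _ (ha _) _) (hmass _ (hb _) _)), ?_⟩
  simp_rw [Fintype.sum_prod_type, sum_bernoulliMixture_fst]
  rw [Fintype.sum_bool, ← sum_add_distrib, ← hw1]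
  refine sum_congr rfl fun u _ => ?_
  simp [bernoulliMass]
  ring

variable (w a b)

theorem bernoulliMixture_distortion :
    (∑ x, ∑ u, ∑ y, if x ≠ y then bernoulliMixture w a b (x, u, y) else 0) =
      ∑ u, w u * (a u * (1 - b u) + (1 - a u) * b u) := by
  simp [bernoulliMixture, bernoulliMass, ← sum_add_distrib, mul_add]

variable {w}

theorem bernoulliMixture_perception (hw : ∀ u, 0 ≤ w u) :
    (∑ u, if 0 < margU (bernoulliMixture w a b) u then
        margU (bernoulliMixture w a b) u *
          |margXU (bernoulliMixture w a b) true u / margU (bernoulliMixture w a b) u -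
            margUXhat (bernoulliMixture w a b) u true / margU (bernoulliMixture w a b) u|
      else 0) = ∑ u, w u * |a u - b u| := by
  refine sum_congr rfl fun u _ => ?_
  simp only [margU_bernoulliMixture, margXU_bernoulliMixture, margUXhat_bernoulliMixture]
  rcases (hw u).eq_or_lt with h | h
  · simp [← h]
  · simp [h, h.ne', bernoulliMass]

theorem bernoulliMixture_entropy (hw : ∀ u, 0 ≤ w u) :
    (∑ u, if 0 < margU (bernoulliMixture w a b) u then
        margU (bernoulliMixture w a b) u *
          Hb (margXU (bernoulliMixture w a b) true u / margU (bernoulliMixture w a b) u)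
      else 0) = ∑ u, w u * Real.binEntropy (a u) := by
  refine sum_congr rfl fun u _ => ?_
  simp only [margU_bernoulliMixture, margXU_bernoulliMixture, Hb_eq_binEntropy]
  rcases (hw u).eq_or_lt with h | h
  · simp [← h]
  · simp [h, h.ne', bernoulliMass]

end bernoulliMixture

/-- Achievability for the uniform Bernoulli source: for every `D ≥ 0` and `P ≥ 0` there is
a Markov triple `(X,U,X̂)` with `U` ranging over a six-element set, uniform `X`,
distortion at most `D`, conditional perception at most `P`, and
`∑_u p_U(u)·H_b(p_{X|U}(1|u)) = ħ̄(D,P)`, so that `I(X;U) = log 2 − ħ̄(D,P)`. -/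
theorem binary_achievability (D P : ℝ) (hD : 0 ≤ D) (hP : 0 ≤ P) :
    ∃ p : Bool × Fin 6 × Bool → ℝ, IsPMF p ∧
      (∀ x : Bool, (∑ u, ∑ y, p (x, u, y)) = 1 / 2) ∧
      (∀ x u y, p (x, u, y) * margU p u = margXU p x u * margUXhat p u y) ∧
      (∑ x, ∑ u, ∑ y, if x ≠ y then p (x, u, y) else 0) ≤ D ∧
      (∑ u, if 0 < margU p u then
          margU p u * |margXU p true u / margU p u - margUXhat p u true / margU p u|
        else 0) ≤ P ∧
      (∑ u, if 0 < margU p u then margU p u * Hb (margXU p true u / margU p u) else 0)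
        = hbarEnv D P := by
  obtain ⟨α, q, hα0, hα1, hq, hle, henv⟩ := exists_hbarEnv_eq D P hD hP
  let e : Fin 6 ≃ Fin 3 × Bool := (Fintype.equivFinOfCardEq (by simp)).symm
  have hsum : ∀ F : Fin 3 × Bool → ℝ, ∑ u, F (e u) = ∑ i, (F (i, true) + F (i, false)) :=
    fun F => by rw [Equiv.sum_comp e F, Fintype.sum_prod_type]; simp
  let w : Fin 6 → ℝ := fun u => α (e u).1 / 2
  let a : Fin 6 → ℝ := fun u => bernoulliMass (crossover (q (e u).1)) (e u).2
  let b : Fin 6 → ℝ := fun u =>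
    bernoulliMass (crossover (q (e u).1) - (q (e u).1).2) (e u).2
  have hw : ∀ u, 0 ≤ w u := fun u => by have := hα0 (e u).1; positivity
  have hb0 : ∀ i, 0 ≤ crossover (q i) - (q i).2 := fun i => sub_nonneg.mpr (le_crossover (hq i))
  have hb1 : ∀ i, crossover (q i) ≤ 1 / 2 := fun i => crossover_le_half (hq i).2.2
  have hmass : ∀ c : ℝ, 0 ≤ c → c ≤ 1 → ∀ x, bernoulliMass c x ∈ Set.Icc (0 : ℝ) 1 := by
    rintro c h0 h1 (_ | _) <;> simp [bernoulliMass, h0, h1]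
  refine ⟨bernoulliMixture w a b, isPMF_bernoulliMixture hw ?_ (fun u => ?_) (fun u => ?_),
    fun x => ?_, bernoulliMixture_markov w a b, ?_, ?_, ?_⟩
  · rw [hsum fun z => α z.1 / 2, ← hα1]
    exact sum_congr rfl fun i _ => by ring
  · exact hmass _ (by linarith [hb0 (e u).1, (hq (e u).1).1]) (by linarith [hb1 (e u).1]) _
  · exact hmass _ (hb0 _) (by linarith [hb1 (e u).1, (hq (e u).1).1]) _
  · rw [sum_bernoulliMixture_fst,
      hsum fun z => α z.1 / 2 * bernoulliMass (bernoulliMass (crossover (q z.1)) z.2) x,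
      ← hα1, sum_div]
    refine sum_congr rfl fun i _ => ?_
    cases x <;> simp [bernoulliMass] <;> ring
  · rw [bernoulliMixture_distortion, hsum fun z => α z.1 / 2 *
      (bernoulliMass (crossover (q z.1)) z.2 *
          (1 - bernoulliMass (crossover (q z.1) - (q z.1).2) z.2) +
        (1 - bernoulliMass (crossover (q z.1)) z.2) *
          bernoulliMass (crossover (q z.1) - (q z.1).2) z.2)]
    have h1 : ∑ i, α i * (q i).1 ≤ D := by simpa [Prod.fst_sum] using hle.1
    refine le_trans (sum_le_sum fun i _ => le_of_eq ?_) h1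
    rw [← crossover_distortion (hq i).2.2]
    simp [bernoulliMass]
    ring
  · rw [bernoulliMixture_perception a b hw, hsum fun z => α z.1 / 2 *
      |bernoulliMass (crossover (q z.1)) z.2 -
        bernoulliMass (crossover (q z.1) - (q z.1).2) z.2|]
    have h1 : ∑ i, α i * (q i).2 ≤ P := by simpa [Prod.snd_sum] using hle.2
    refine le_trans (sum_le_sum fun i _ => le_of_eq ?_) h1
    simp [bernoulliMass, abs_of_nonneg (hq i).1]
    ring
  · rw [bernoulliMixture_entropy a b hw, henv, hsum fun z => α z.1 / 2 *
      Real.binEntropy (bernoulliMass (crossover (q z.1)) z.2)]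
    refine sum_congr rfl fun i _ => ?_
    simp [bernoulliMass]
    ring
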